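/- Let γ ∈ (0,1), A > 0, p < 0, u₀ > 0, and let u be the solution of D_c^γ u = A u^p, u(0) = u₀. Then u exists globally on [0, ∞), is increasing, and satisfies u₀ ≤ u(t) ≤ u₀ + A u₀^p t^γ / Γ(1+γ) for all t ≥ 0. -/

import Mathlib

open MeasureTheory Real Filter Set Asymptotics
open scoped ENNReal Topology

/-- `u` is a solution of the Volterra integral form of the fractional ODE
`D_c^γ u = f(u)`, `u(0) = u₀`, on the interval `[0, T)` (with `T ∈ (0,∞]`),
taking values in the set `D`. -/
noncomputable def IsSolUpTo (γ : ℝ) (f : ℝ → ℝ) (D : Set ℝ) (u₀ : ℝ) (u : ℝ → ℝ)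
    (T : ℝ≥0∞) : Prop :=
  u 0 = u₀ ∧
  ContinuousOn u {t : ℝ | 0 ≤ t ∧ ENNReal.ofReal t < T} ∧
  (∀ t : ℝ, 0 ≤ t → ENNReal.ofReal t < T → u t ∈ D) ∧
  (∀ t : ℝ, 0 ≤ t → ENNReal.ofReal t < T →
    u t = u₀ + (1 / Real.Gamma γ) * ∫ s in (0:ℝ)..t, (t - s) ^ (γ - 1) * f (u s))

/-- The maximal existence time `T_b`: the supremum of all `T` such that a solution
exists on `[0, T)`. -/
noncomputable def maxTime (γ : ℝ) (f : ℝ → ℝ) (D : Set ℝ) (u₀ : ℝ) : ℝ≥0∞ :=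
  sSup {T : ℝ≥0∞ | ∃ u : ℝ → ℝ, IsSolUpTo γ f D u₀ u T}



lemma ker_ii {γ : ℝ} (hγ : 0 < γ) (a b t : ℝ) :
    IntervalIntegrable (fun s => (t - s) ^ (γ - 1)) volume a b := by
  have h := (intervalIntegral.intervalIntegrable_rpow' (r := γ - 1) (a := t - a) (b := t - b)
    (by linarith)).comp_sub_left t
  simpa using h

lemma ker_mul_ii {γ : ℝ} (hγ : 0 < γ) {a b t : ℝ} {g : ℝ → ℝ} (hg : ContinuousOn g (Set.uIcc a b)) :
    IntervalIntegrable (fun s => (t - s) ^ (γ - 1) * g s) volume a b :=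
  (ker_ii hγ a b t).mul_continuousOn hg

lemma ker_integral {γ : ℝ} (hγ : 0 < γ) (a t : ℝ) :
    ∫ s in a..t, (t - s) ^ (γ - 1) = (t - a) ^ γ / γ := by
  rw [intervalIntegral.integral_comp_sub_left (fun x => x ^ (γ - 1)) t]
  rw [integral_rpow (Or.inl (by linarith))]
  simp [Real.zero_rpow hγ.ne']

lemma exp_bound {γ lam : ℝ} (hγ : 0 < γ) (hl : 0 < lam) {g : ℝ → ℝ} (hg : Continuous g)
    {C t : ℝ} (ht : 0 ≤ t) (hC : ∀ s, 0 ≤ s → |g s| ≤ C * Real.exp (lam * s)) :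
    |∫ s in (0:ℝ)..t, (t - s) ^ (γ - 1) * g s| ≤
      C * Real.exp (lam * t) * ((1 / lam) ^ γ * Real.Gamma γ) := by
  have hC0 : 0 ≤ C := by
    have := (abs_nonneg _).trans (hC 0 le_rfl)
    simpa using this
  have hint : IntegrableOn (fun r : ℝ => r ^ (γ - 1) * Real.exp (-(lam * r))) (Set.Ioi 0) := by
    have := integrableOn_rpow_mul_exp_neg_mul_rpow (p := 1) (s := γ - 1) (b := lam)
      (by linarith) one_pos hl
    simpa using this
  have h1 : |∫ s in (0:ℝ)..t, (t - s) ^ (γ - 1) * g s| ≤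
      ∫ s in (0:ℝ)..t, (t - s) ^ (γ - 1) * (C * Real.exp (lam * s)) := by
    refine (intervalIntegral.abs_integral_le_integral_abs ht).trans ?_
    refine intervalIntegral.integral_mono_on ht (ker_mul_ii hγ hg.continuousOn).abs
      (ker_mul_ii hγ (by fun_prop)) ?_
    intro s hs
    rw [abs_mul, abs_of_nonneg (Real.rpow_nonneg (by linarith [hs.2]) _)]
    exact mul_le_mul_of_nonneg_left (hC s hs.1) (Real.rpow_nonneg (by linarith [hs.2]) _)
  have h2 : ∫ s in (0:ℝ)..t, (t - s) ^ (γ - 1) * (C * Real.exp (lam * s)) =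
      C * Real.exp (lam * t) * ∫ r in (0:ℝ)..t, r ^ (γ - 1) * Real.exp (-(lam * r)) := by
    have := intervalIntegral.integral_comp_sub_left
      (fun r : ℝ => r ^ (γ - 1) * Real.exp (-(lam * r))) (a := 0) (b := t) t
    rw [sub_self, sub_zero] at this
    rw [← this, ← intervalIntegral.integral_const_mul]
    congr 1
    ext s
    have : Real.exp (lam * s) = Real.exp (lam * t) * Real.exp (-(lam * (t - s))) := by
      rw [← Real.exp_add]; ring_nf
    rw [this]; ring
  have h3 : ∫ r in (0:ℝ)..t, r ^ (γ - 1) * Real.exp (-(lam * r)) ≤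
      (1 / lam) ^ γ * Real.Gamma γ := by
    rw [← Real.integral_rpow_mul_exp_neg_mul_Ioi hγ hl, intervalIntegral.integral_of_le ht]
    refine setIntegral_mono_set hint ?_ (Set.Ioc_subset_Ioi_self.eventuallyLE)
    filter_upwards [self_mem_ae_restrict measurableSet_Ioi] with r hr
    exact mul_nonneg (Real.rpow_nonneg (le_of_lt hr) _) (Real.exp_pos _).le
  rw [h2] at h1
  exact h1.trans (mul_le_mul_of_nonneg_left h3 (by positivity))

lemma vol_cont {γ : ℝ} (hγ : 0 < γ) {g : ℝ → ℝ} (hg : Continuous g) {M : ℝ}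
    (hM : ∀ s, |g s| ≤ M) :
    Continuous (fun t : ℝ => ∫ s in (0:ℝ)..|t|, (|t| - s) ^ (γ - 1) * g s) := by
  have key : ∀ t : ℝ, ∫ s in (0:ℝ)..|t|, (|t| - s) ^ (γ - 1) * g s =
      |t| ^ γ * ∫ x in (0:ℝ)..1, (1 - x) ^ (γ - 1) * g (|t| * x) := by
    intro t
    rcases (abs_nonneg t).eq_or_lt with h | h
    · rw [← h]; simp [Real.zero_rpow hγ.ne']
    · have := intervalIntegral.smul_integral_comp_mul_left (a := 0) (b := 1)
        (fun s => (|t| - s) ^ (γ - 1) * g s) (|t|)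
      simp only [mul_zero, mul_one, smul_eq_mul] at this
      rw [← this]
      have h2 : |t| ^ γ = |t| * |t| ^ (γ - 1) := by
        rw [Real.rpow_sub_one h.ne']; field_simp
      rw [h2, mul_assoc, ← intervalIntegral.integral_const_mul (|t| ^ (γ - 1))]
      congr 1
      refine intervalIntegral.integral_congr ?_
      intro x hx
      rw [Set.uIcc_of_le zero_le_one] at hx
      have : |t| - |t| * x = |t| * (1 - x) := by ring
      simp only [this]
      rw [Real.mul_rpow h.le (by linarith [hx.2])]
      ring
  simp_rw [key]
  refine ((Real.continuous_rpow_const hγ.le).comp continuous_abs).mul ?_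
  refine intervalIntegral.continuous_of_dominated_interval
    (bound := fun x => |(1 - x) ^ (γ - 1)| * M) ?_ ?_ ?_ ?_
  · intro t
    have : IntervalIntegrable (fun x => (1 - x) ^ (γ - 1) * g (|t| * x)) volume 0 1 :=
      ker_mul_ii hγ (by fun_prop)
    exact (intervalIntegrable_iff.1 this).aestronglyMeasurable
  · intro t
    refine Filter.Eventually.of_forall fun x _ => ?_
    rw [Real.norm_eq_abs, abs_mul]
    exact mul_le_mul_of_nonneg_left (hM _) (abs_nonneg _)
  · exact (ker_ii hγ 0 1 1).abs.mul_const M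
  · refine Filter.Eventually.of_forall fun x _ => ?_
    fun_prop

lemma rpow_lip {p a : ℝ} (hp : p < 0) (ha : 0 < a) {x y : ℝ} (hx : a ≤ x) (hy : a ≤ y) :
    |y ^ p - x ^ p| ≤ (-p * a ^ (p - 1)) * |y - x| := by
  have := (convex_Ici a).norm_image_sub_le_of_norm_hasDerivWithin_le
    (f := fun x : ℝ => x ^ p) (f' := fun x => p * x ^ (p - 1)) (C := -p * a ^ (p - 1)) ?_ ?_ hx hy
  · simpa using this
  · intro z hz
    have hz' : 0 < z := ha.trans_le hz
    exact (Real.hasDerivAt_rpow_const (Or.inl hz'.ne')).hasDerivWithinAt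
  · intro z hz
    have hz' : 0 < z := ha.trans_le hz
    rw [norm_mul, Real.norm_eq_abs, Real.norm_eq_abs, abs_of_neg hp,
      abs_of_pos (Real.rpow_pos_of_pos hz' _)]
    exact mul_le_mul_of_nonneg_left (Real.rpow_le_rpow_of_nonpos ha hz (by linarith)) (by linarith)

lemma exists_global {γ p A u₀ : ℝ} (hγ : 0 < γ) (hA : 0 < A) (hp : p < 0) (hu₀ : 0 < u₀) :
    ∃ u : ℝ → ℝ, IsSolUpTo γ (fun x => A * x ^ p) (Set.Ioi 0) u₀ u ⊤ := by
  set f : ℝ → ℝ := fun x => A * (max x u₀) ^ p with hf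
  set L : ℝ := A * (-p * u₀ ^ (p - 1)) with hL
  have hL0 : 0 ≤ L := mul_nonneg hA.le (mul_nonneg (by linarith) (Real.rpow_nonneg hu₀.le _))
  have hfL : ∀ x y, |f x - f y| ≤ L * |x - y| := by
    intro x y
    have h1 := rpow_lip hp hu₀ (le_max_right y u₀) (le_max_right x u₀)
    have h2 : |max x u₀ - max y u₀| ≤ |x - y| := abs_max_sub_max_le_abs x y u₀
    simp only [hf, ← mul_sub, abs_mul, abs_of_pos hA, hL, mul_assoc]
    refine mul_le_mul_of_nonneg_left (h1.trans ?_) hA.le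
    rw [mul_assoc]
    exact mul_le_mul_of_nonneg_left (mul_le_mul_of_nonneg_left h2 (Real.rpow_nonneg hu₀.le _))
      (by linarith)
  have hf0 : ∀ x, 0 < f x := fun x =>
    mul_pos hA (Real.rpow_pos_of_pos (hu₀.trans_le (le_max_right _ _)) _)
  have hfM : ∀ x, |f x| ≤ A * u₀ ^ p := by
    intro x
    rw [abs_of_pos (hf0 x)]
    exact mul_le_mul_of_nonneg_left
      (Real.rpow_le_rpow_of_nonpos hu₀ (le_max_right _ _) hp.le) hA.le
  have hfc : Continuous f := by
    refine continuous_const.mul ?_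
    refine (continuous_id.max continuous_const).rpow_const ?_
    intro x
    exact Or.inl (hu₀.trans_le (le_max_right _ _)).ne'
  have hM0 : 0 ≤ A * u₀ ^ p := mul_nonneg hA.le (Real.rpow_nonneg hu₀.le _)
  obtain ⟨lam, hlam, hlamL⟩ : ∃ lam : ℝ, 0 < lam ∧ L * (1 / lam) ^ γ ≤ 1 / 2 := by
    have ht : Tendsto (fun lam : ℝ => L * lam ^ (-γ)) atTop (𝓝 (L * 0)) :=
      (tendsto_rpow_neg_atTop hγ).const_mul L
    rw [mul_zero] at ht
    have := (ht.eventually_le_const (show (0:ℝ) < 1 / 2 by norm_num)).and (eventually_gt_atTop 0)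
    obtain ⟨lam, h1, h2⟩ := this.exists
    refine ⟨lam, h2, ?_⟩
    rwa [one_div, Real.inv_rpow h2.le, ← Real.rpow_neg h2.le]
  have hG : 0 < Real.Gamma γ := Real.Gamma_pos_of_pos hγ
  let V : (ℝ → ℝ) → ℝ → ℝ := fun w t =>
    ∫ s in (0:ℝ)..t, (t - s) ^ (γ - 1) * f (Real.exp (lam * s) * w s)
  let Φ₀ : (ℝ → ℝ) → ℝ → ℝ := fun w t =>
    Real.exp (-(lam * |t|)) * (u₀ + (1 / Real.Gamma γ) * V w |t|)
  have hΦc : ∀ w : BoundedContinuousFunction ℝ ℝ, Continuous (Φ₀ w) := by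
    intro w
    refine Continuous.mul (by fun_prop) (continuous_const.add (continuous_const.mul ?_))
    exact vol_cont hγ (g := fun s => f (Real.exp (lam * s) * w s)) (by fun_prop) (fun s => hfM _)
  have hexp : ∀ t : ℝ, Real.exp (-(lam * t)) * Real.exp (lam * t) = 1 := by
    intro t; rw [← Real.exp_add]; simp
  have hΦb : ∀ (w : BoundedContinuousFunction ℝ ℝ) (t : ℝ),
      ‖Φ₀ w t‖ ≤ u₀ + A * u₀ ^ p * (1 / lam) ^ γ := by
    intro w t
    have h1 := exp_bound hγ hlam (g := fun s => f (Real.exp (lam * s) * w s)) (C := A * u₀ ^ p)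
      (by fun_prop) (abs_nonneg t) (fun s hs => (hfM _).trans
        (le_mul_of_one_le_right hM0 (Real.one_le_exp (by positivity))))
    have h2 : abs (V w |t|) ≤ _ := h1
    simp only [Φ₀]
    rw [Real.norm_eq_abs, abs_mul, abs_of_pos (Real.exp_pos _)]
    have h3 : abs (u₀ + 1 / Real.Gamma γ * V w |t|) ≤ Real.exp (lam * |t|) *
        (u₀ + A * u₀ ^ p * (1 / lam) ^ γ) := by
      refine (abs_add_le _ _).trans ?_
      rw [abs_of_pos hu₀, abs_mul, abs_of_pos (by positivity : 0 < 1 / Real.Gamma γ), mul_add]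
      refine add_le_add (le_mul_of_one_le_left hu₀.le (Real.one_le_exp (by positivity))) ?_
      refine (mul_le_mul_of_nonneg_left h2 (by positivity)).trans (le_of_eq ?_)
      field_simp
    calc _ ≤ Real.exp (-(lam * |t|)) * (Real.exp (lam * |t|) *
        (u₀ + A * u₀ ^ p * (1 / lam) ^ γ)) :=
          mul_le_mul_of_nonneg_left h3 (Real.exp_pos _).le
      _ = _ := by rw [← mul_assoc, hexp, one_mul]
  let Φ : BoundedContinuousFunction ℝ ℝ → BoundedContinuousFunction ℝ ℝ := fun w =>
    BoundedContinuousFunction.ofNormedAddCommGroup (Φ₀ w) (hΦc w) _ (hΦb w)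
  have hΦ : ContractingWith (1 / 2) Φ := by
    refine ⟨by rw [← NNReal.coe_lt_coe]; norm_num, LipschitzWith.of_dist_le_mul ?_⟩
    intro w v
    refine (BoundedContinuousFunction.dist_le (by positivity)).2 ?_
    intro t
    change dist (Φ₀ w t) (Φ₀ v t) ≤ _
    have h1 := exp_bound hγ hlam
      (g := fun s => f (Real.exp (lam * s) * w s) - f (Real.exp (lam * s) * v s))
      (C := L * dist w v) (by fun_prop) (abs_nonneg t) (by
        intro s hs
        refine (hfL _ _).trans ?_
        rw [← mul_sub, abs_mul, abs_of_pos (Real.exp_pos _)]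
        have : |w s - v s| ≤ dist w v := by
          rw [← Real.dist_eq]; exact BoundedContinuousFunction.dist_coe_le_dist s
        calc _ ≤ L * (Real.exp (lam * s) * dist w v) := by gcongr
          _ = _ := by ring)
    have h2 : ∫ s in (0:ℝ)..|t|, (|t| - s) ^ (γ - 1) *
        (f (Real.exp (lam * s) * w s) - f (Real.exp (lam * s) * v s)) = V w |t| - V v |t| := by
      simp only [V, mul_sub]
      exact intervalIntegral.integral_sub (ker_mul_ii hγ (by fun_prop)) (ker_mul_ii hγ (by fun_prop))
    rw [h2] at h1
    have h3 : Φ₀ w t - Φ₀ v t =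
      Real.exp (-(lam * |t|)) * (1 / Real.Gamma γ) * (V w |t| - V v |t|) := by
      simp only [Φ₀]; ring
    rw [Real.dist_eq, h3, abs_mul, abs_of_pos (by positivity)]
    calc _ ≤ Real.exp (-(lam * |t|)) * (1 / Real.Gamma γ) *
          (L * dist w v * Real.exp (lam * |t|) * ((1 / lam) ^ γ * Real.Gamma γ)) :=
            mul_le_mul_of_nonneg_left h1 (by positivity)
      _ = (Real.exp (-(lam * |t|)) * Real.exp (lam * |t|)) * (L * (1 / lam) ^ γ) * dist w v := by
            field_simp
      _ ≤ _ := by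
            rw [hexp, one_mul]
            refine (mul_le_mul_of_nonneg_right hlamL dist_nonneg).trans (le_of_eq ?_)
            simp
  obtain ⟨w, hw⟩ : ∃ w, Φ w = w := ⟨_, hΦ.fixedPoint_isFixedPt⟩
  have hw' : ∀ t, 0 ≤ t → Real.exp (lam * t) * w t = u₀ + (1 / Real.Gamma γ) * V w t := by
    intro t ht
    have : Φ₀ w t = w t := congrArg (fun v : BoundedContinuousFunction ℝ ℝ => v t) hw
    rw [← this]
    simp only [Φ₀, abs_of_nonneg ht]
    rw [← mul_assoc, mul_comm (Real.exp (lam * t)), hexp, one_mul]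
  have hge : ∀ t, 0 ≤ t → u₀ ≤ Real.exp (lam * t) * w t := by
    intro t ht
    rw [hw' t ht]
    have : 0 ≤ V w t := intervalIntegral.integral_nonneg ht fun s hs =>
      mul_nonneg (Real.rpow_nonneg (by linarith [hs.2]) _) (hf0 _).le
    have : 0 ≤ 1 / Real.Gamma γ * V w t := by positivity
    linarith
  refine ⟨fun t => Real.exp (lam * t) * w t, ?_, ?_, ?_, ?_⟩
  · have := hw' 0 le_rfl
    simpa [V] using this
  · exact Continuous.continuousOn (by fun_prop)
  · intro t ht _
    exact hu₀.trans_le (hge t ht)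
  · intro t ht _
    change Real.exp (lam * t) * w t = _
    rw [hw' t ht]
    congr 2
    refine intervalIntegral.integral_congr ?_
    intro s hs
    rw [Set.uIcc_of_le ht] at hs
    simp only [hf, max_eq_left (hge s hs.1)]


lemma shift_pos {γ L : ℝ} (hγ : γ ∈ Set.Ioo (0:ℝ) 1) (hL : 0 ≤ L) {c h : ℝ} (hc : 0 < c)
    (hh : 0 < h) {w g F : ℝ → ℝ} (hF : ContinuousOn F (Set.Ici 0)) (hF0 : ∀ s, 0 ≤ s → 0 ≤ F s)
    (hw : ContinuousOn w (Set.Ici 0)) (hg : ContinuousOn g (Set.Ici 0)) (hw0 : 0 < w 0)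
    (hgw : ∀ s, 0 ≤ s → 0 ≤ w s → 0 ≤ g s ∧ g s ≤ L * w s)
    (heq : ∀ t, 0 ≤ t → w t = c * ((∫ s in (0:ℝ)..h, (t + h - s) ^ (γ - 1) * F s) -
      ∫ s in (0:ℝ)..t, (t - s) ^ (γ - 1) * g s)) :
    ∀ t, 0 ≤ t → 0 < w t := by
  obtain ⟨hγ0, hγ1⟩ := hγ
  by_contra! hcon
  obtain ⟨tb, htb0, htb⟩ := hcon
  -- the first zero
  have hcl : IsClosed (Set.Ici (0:ℝ) ∩ w ⁻¹' Set.Iic 0) :=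
    hw.preimage_isClosed_of_isClosed isClosed_Ici isClosed_Iic
  set S := Set.Ici (0:ℝ) ∩ w ⁻¹' Set.Iic 0 with hS
  have hbdd : BddBelow S := ⟨0, fun x hx => hx.1⟩
  have hmem : sInf S ∈ S := hcl.csInf_mem ⟨tb, htb0, htb⟩ hbdd
  set t₁ := sInf S with ht₁
  have hpos : ∀ s, 0 ≤ s → s < t₁ → 0 < w s := by
    intro s hs hst
    by_contra! hle
    exact absurd (csInf_le hbdd (show s ∈ S from ⟨hs, hle⟩)) (not_le.2 hst)
  have h1 : 0 < t₁ := by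
    rcases (show 0 ≤ t₁ from hmem.1).eq_or_lt with h | h
    · have : w t₁ ≤ 0 := hmem.2
      rw [← h] at this; linarith
    · exact h
  have hw1 : w t₁ ≤ 0 := hmem.2
  obtain ⟨δ, hδ0, hδ⟩ : ∃ δ : ℝ, 0 < δ ∧ c * (L * (δ ^ γ / γ)) < 1 / 2 := by
    have : Tendsto (fun δ : ℝ => c * (L * (δ ^ γ / γ))) (𝓝[>] 0) (𝓝 (c * (L * (0 ^ γ / γ)))) := by
      have h := ((Real.continuous_rpow_const hγ0.le).div_const γ).const_mul L |>.const_mul c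
      exact (h.tendsto 0).mono_left nhdsWithin_le_nhds
    rw [Real.zero_rpow hγ0.ne', zero_div, mul_zero, mul_zero] at this
    obtain ⟨δ, h1, h2⟩ := ((this.eventually_lt_const (show (0:ℝ) < 1 / 2 by norm_num)).and
      self_mem_nhdsWithin).exists
    exact ⟨δ, h2, h1⟩
  set η := min δ (t₁ / 2) with hη
  have hη0 : 0 < η := lt_min hδ0 (by linarith)
  have hη1 : η ≤ δ := min_le_left _ _
  have hη2 : η ≤ t₁ / 2 := min_le_right _ _
  obtain ⟨t₀, ht₀, hmax⟩ := isCompact_Icc.exists_isMaxOn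
    (show (Set.Icc (t₁ - η) t₁).Nonempty from ⟨t₁, by constructor <;> linarith⟩)
    (hw.mono fun x hx => by have := hx.1; simp only [Set.mem_Ici]; linarith)
  have hwt0 : 0 < w t₀ := by
    have h2 := hpos (t₁ - η) (by linarith) (by linarith)
    have h3 : w (t₁ - η) ≤ w t₀ := hmax (show t₁ - η ∈ Set.Icc (t₁ - η) t₁ by
      constructor <;> linarith)
    linarith
  have ht01 : t₀ < t₁ := by
    rcases ht₀.2.eq_or_lt with h | h
    · rw [h] at hwt0; linarith
    · exact h
  have ht0 : 0 < t₀ := by linarith [ht₀.1]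
  have hg0 : ∀ s, 0 ≤ s → s < t₁ → 0 ≤ g s := fun s hs hst => (hgw s hs (hpos s hs hst).le).1
  set ρ := (t₁ / t₀) ^ (γ - 1) with hρ
  have hq : 0 < t₁ / t₀ := by positivity
  have hρ0 : 1 / 2 ≤ ρ := by
    have h2 : t₁ / t₀ ≤ 2 := by
      rw [div_le_iff₀ ht0]; linarith [ht₀.1]
    calc (1:ℝ) / 2 = 2 ^ (-1 : ℝ) := by rw [Real.rpow_neg_one]; norm_num
      _ ≤ 2 ^ (γ - 1) := Real.rpow_le_rpow_of_exponent_le (by norm_num) (by linarith)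
      _ ≤ ρ := Real.rpow_le_rpow_of_nonpos hq h2 (by linarith)
  have sub : ∀ {a b : ℝ}, 0 ≤ a → 0 ≤ b → Set.uIcc a b ⊆ Set.Ici 0 := by
    intro a b ha hb x hx
    exact (le_min ha hb).trans hx.1
  -- history term
  have e1 : ρ * ∫ s in (0:ℝ)..h, (t₀ + h - s) ^ (γ - 1) * F s ≤
      ∫ s in (0:ℝ)..h, (t₁ + h - s) ^ (γ - 1) * F s := by
    rw [← intervalIntegral.integral_const_mul]
    refine intervalIntegral.integral_mono_on hh.le
      ((ker_mul_ii hγ0 (hF.mono (sub le_rfl hh.le))).const_mul ρ)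
      (ker_mul_ii hγ0 (hF.mono (sub le_rfl hh.le))) ?_
    intro s hs
    rw [← mul_assoc]
    refine mul_le_mul_of_nonneg_right ?_ (hF0 s hs.1)
    rw [hρ, ← Real.mul_rpow hq.le (by linarith [hs.2])]
    refine Real.rpow_le_rpow_of_nonpos (by linarith [hs.2]) ?_ (by linarith)
    have : 1 ≤ t₁ / t₀ := by rw [le_div_iff₀ ht0]; linarith
    have h5 : t₁ / t₀ * t₀ = t₁ := by field_simp
    nlinarith [hs.2]
  have e2 : ∫ s in (0:ℝ)..t₀, (t₁ - s) ^ (γ - 1) * g s ≤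
      ρ * ∫ s in (0:ℝ)..t₀, (t₀ - s) ^ (γ - 1) * g s := by
    rw [← intervalIntegral.integral_const_mul]
    refine intervalIntegral.integral_mono_on_of_le_Ioo ht0.le
      (ker_mul_ii hγ0 (hg.mono (sub le_rfl ht0.le)))
      ((ker_mul_ii hγ0 (hg.mono (sub le_rfl ht0.le))).const_mul ρ) ?_
    intro s hs
    rw [← mul_assoc]
    refine mul_le_mul_of_nonneg_right ?_ (hg0 s hs.1.le (hs.2.trans ht01))
    have h4 : 0 < t₀ - s := by linarith [hs.2]
    rw [hρ, ← Real.mul_rpow hq.le h4.le]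
    refine Real.rpow_le_rpow_of_nonpos (by positivity) ?_ (by linarith)
    have : 1 ≤ t₁ / t₀ := by rw [le_div_iff₀ ht0]; linarith
    have h5 : t₁ / t₀ * t₀ = t₁ := by field_simp
    nlinarith [hs.1]
  have e3 : ∫ s in t₀..t₁, (t₁ - s) ^ (γ - 1) * g s ≤ (δ ^ γ / γ) * (L * w t₀) := by
    have : ∫ s in t₀..t₁, (t₁ - s) ^ (γ - 1) * g s ≤
        ∫ s in t₀..t₁, (t₁ - s) ^ (γ - 1) * (L * w t₀) := by
      refine intervalIntegral.integral_mono_on_of_le_Ioo ht01.le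
        (ker_mul_ii hγ0 (hg.mono (sub ht0.le h1.le)))
        (ker_mul_ii hγ0 continuousOn_const) ?_
      intro s hs
      refine mul_le_mul_of_nonneg_left ?_ (Real.rpow_nonneg (by linarith [hs.2]) _)
      have hs0 : 0 ≤ s := by linarith [hs.1]
      refine (hgw s hs0 (hpos s hs0 hs.2).le).2.trans (mul_le_mul_of_nonneg_left ?_ hL)
      exact hmax ⟨by linarith [ht₀.1, hs.1], hs.2.le⟩
    refine this.trans ?_
    rw [intervalIntegral.integral_mul_const, ker_integral hγ0]
    refine mul_le_mul_of_nonneg_right ?_ (mul_nonneg hL hwt0.le)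
    refine div_le_div_of_nonneg_right ?_ hγ0.le
    exact Real.rpow_le_rpow (by linarith) (by linarith [ht₀.1]) hγ0.le
  have e4 : ∫ s in (0:ℝ)..t₁, (t₁ - s) ^ (γ - 1) * g s =
      (∫ s in (0:ℝ)..t₀, (t₁ - s) ^ (γ - 1) * g s) + ∫ s in t₀..t₁, (t₁ - s) ^ (γ - 1) * g s :=
    (intervalIntegral.integral_add_adjacent_intervals
      (ker_mul_ii hγ0 (hg.mono (sub le_rfl ht0.le)))
      (ker_mul_ii hγ0 (hg.mono (sub ht0.le h1.le)))).symm
  have q0 := heq t₀ ht0.le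
  have q1 := heq t₁ h1.le
  rw [e4] at q1
  set P0 := ∫ s in (0:ℝ)..h, (t₀ + h - s) ^ (γ - 1) * F s
  set P1 := ∫ s in (0:ℝ)..h, (t₁ + h - s) ^ (γ - 1) * F s
  set Q0 := ∫ s in (0:ℝ)..t₀, (t₀ - s) ^ (γ - 1) * g s
  set Q1 := ∫ s in (0:ℝ)..t₀, (t₁ - s) ^ (γ - 1) * g s
  set R := ∫ s in t₀..t₁, (t₁ - s) ^ (γ - 1) * g s
  have f1 : c * (ρ * P0 - ρ * Q0 - (δ ^ γ / γ) * (L * w t₀)) ≤ w t₁ := by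
    rw [q1]; exact mul_le_mul_of_nonneg_left (by linarith) hc.le
  have f2 : c * (ρ * P0 - ρ * Q0 - (δ ^ γ / γ) * (L * w t₀)) =
      (ρ - c * (L * (δ ^ γ / γ))) * w t₀ := by
    have : ρ * w t₀ = ρ * (c * (P0 - Q0)) := by rw [← q0]
    linear_combination -this
  have : 0 < (ρ - c * (L * (δ ^ γ / γ))) * w t₀ := mul_pos (by linarith) hwt0
  linarith

/-- `A > 0`, `p < 0`: global existence, monotonicity as well as
two-sided bounds for the solution. -/
theorem stmt14 (γ p A u₀ : ℝ) (u : ℝ → ℝ)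
    (hγ : γ ∈ Set.Ioo (0:ℝ) 1) (hA : 0 < A) (hp : p < 0) (hu₀ : 0 < u₀)
    (hu : IsSolUpTo γ (fun x => A * x ^ p) (Set.Ioi 0) u₀ u
      (maxTime γ (fun x => A * x ^ p) (Set.Ioi 0) u₀)) :
    maxTime γ (fun x => A * x ^ p) (Set.Ioi 0) u₀ = ⊤ ∧
    StrictMonoOn u (Set.Ici 0) ∧
    (∀ t : ℝ, 0 ≤ t →
      u₀ ≤ u t ∧ u t ≤ u₀ + A * u₀ ^ p * t ^ γ / Real.Gamma (1 + γ)) := by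
  have hγ0 := hγ.1
  have hmt : maxTime γ (fun x => A * x ^ p) (Set.Ioi 0) u₀ = ⊤ :=
    top_unique (le_sSup (exists_global hγ0 hA hp hu₀))
  rw [hmt] at hu
  obtain ⟨hu0, hucont, hupos, hueq⟩ := hu
  have hucont' : ContinuousOn u (Set.Ici 0) :=
    hucont.mono fun t ht => ⟨ht, ENNReal.ofReal_lt_top⟩
  have hupos' : ∀ t, 0 ≤ t → 0 < u t := fun t ht => hupos t ht ENNReal.ofReal_lt_top
  have hueq' : ∀ t, 0 ≤ t →
      u t = u₀ + (1 / Real.Gamma γ) * ∫ s in (0:ℝ)..t, (t - s) ^ (γ - 1) * (A * u s ^ p) :=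
    fun t ht => hueq t ht ENNReal.ofReal_lt_top
  have hG : 0 < Real.Gamma γ := Real.Gamma_pos_of_pos hγ0
  have hFc : ContinuousOn (fun s => A * u s ^ p) (Set.Ici 0) :=
    continuousOn_const.mul (hucont'.rpow_const fun s hs => Or.inl (hupos' s hs).ne')
  have hF0 : ∀ s, 0 ≤ s → 0 < A * u s ^ p := fun s hs =>
    mul_pos hA (Real.rpow_pos_of_pos (hupos' s hs) _)
  have sub : ∀ {a b : ℝ}, 0 ≤ a → 0 ≤ b → Set.uIcc a b ⊆ Set.Ici 0 := by
    intro a b ha hb x hx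
    exact (le_min ha hb).trans hx.1
  have hlow : ∀ t, 0 ≤ t → u₀ ≤ u t := by
    intro t ht
    rw [hueq' t ht]
    have : 0 ≤ ∫ s in (0:ℝ)..t, (t - s) ^ (γ - 1) * (A * u s ^ p) :=
      intervalIntegral.integral_nonneg ht fun s hs =>
        mul_nonneg (Real.rpow_nonneg (by linarith [hs.2]) _) (hF0 s hs.1).le
    have : 0 ≤ 1 / Real.Gamma γ * ∫ s in (0:ℝ)..t, (t - s) ^ (γ - 1) * (A * u s ^ p) := by
      positivity
    linarith
  have hlow' : ∀ t, 0 < t → u₀ < u t := by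
    intro t ht
    rw [hueq' t ht.le]
    have : 0 < ∫ s in (0:ℝ)..t, (t - s) ^ (γ - 1) * (A * u s ^ p) := by
      refine intervalIntegral.intervalIntegral_pos_of_pos_on
        (ker_mul_ii hγ0 (hFc.mono (sub le_rfl ht.le))) ?_ ht
      intro s hs
      exact mul_pos (Real.rpow_pos_of_pos (by linarith [hs.2]) _) (hF0 s hs.1.le)
    have : 0 < 1 / Real.Gamma γ * ∫ s in (0:ℝ)..t, (t - s) ^ (γ - 1) * (A * u s ^ p) := by
      positivity
    linarith
  refine ⟨hmt, ?_, ?_⟩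
  · have main : ∀ h, 0 < h → ∀ t, 0 ≤ t → 0 < u (t + h) - u t := by
      intro h hh
      have hsc : ContinuousOn (fun s => u (s + h)) (Set.Ici 0) :=
        hucont'.comp (by fun_prop) fun s hs => by
          simp only [Set.mem_Ici] at hs ⊢; linarith
      have hFsc : ContinuousOn (fun s => A * u (s + h) ^ p) (Set.Ici 0) :=
        hFc.comp (f := fun s => s + h) (by fun_prop) fun s hs => by
          simp only [Set.mem_Ici] at hs ⊢; linarith
      refine shift_pos (L := A * (-p * u₀ ^ (p - 1))) (c := 1 / Real.Gamma γ) (h := h)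
        (F := fun s => A * u s ^ p) (w := fun t => u (t + h) - u t)
        (g := fun s => A * u s ^ p - A * u (s + h) ^ p)
        hγ ?_ (by positivity) hh hFc (fun s hs => (hF0 s hs).le) (hsc.sub hucont')
        (hFc.sub hFsc) ?_ ?_ ?_
      · exact mul_nonneg hA.le (mul_nonneg (by linarith) (Real.rpow_nonneg hu₀.le _))
      · simp only [zero_add, hu0]; linarith [hlow' h hh]
      · intro s hs hws
        have hle : u s ≤ u (s + h) := by linarith
        constructor
        · have := mul_le_mul_of_nonneg_left
            (Real.rpow_le_rpow_of_nonpos (hupos' s hs) hle hp.le) hA.le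
          linarith
        · have h1 := rpow_lip hp hu₀ (hlow (s + h) (by linarith)) (hlow s hs)
          rw [abs_sub_comm (u s), abs_of_nonneg hws] at h1
          have h2 := mul_le_mul_of_nonneg_left ((le_abs_self _).trans h1) hA.le
          linarith
      · intro t ht
        have i1 : ∫ s in (0:ℝ)..(t + h), (t + h - s) ^ (γ - 1) * (A * u s ^ p) =
            (∫ s in (0:ℝ)..h, (t + h - s) ^ (γ - 1) * (A * u s ^ p)) +
            ∫ s in h..(t + h), (t + h - s) ^ (γ - 1) * (A * u s ^ p) :=
          (intervalIntegral.integral_add_adjacent_intervals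
            (ker_mul_ii hγ0 (hFc.mono (sub le_rfl hh.le)))
            (ker_mul_ii hγ0 (hFc.mono (sub hh.le (by linarith))))).symm
        have i2 : ∫ s in h..(t + h), (t + h - s) ^ (γ - 1) * (A * u s ^ p) =
            ∫ s in (0:ℝ)..t, (t - s) ^ (γ - 1) * (A * u (s + h) ^ p) := by
          have := intervalIntegral.integral_comp_add_right (a := 0) (b := t)
            (fun s => (t + h - s) ^ (γ - 1) * (A * u s ^ p)) h
          rw [zero_add] at this
          rw [← this]
          simp only [add_sub_add_right_eq_sub]
        have i3 : ∫ s in (0:ℝ)..t, (t - s) ^ (γ - 1) * (A * u s ^ p - A * u (s + h) ^ p) =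
            (∫ s in (0:ℝ)..t, (t - s) ^ (γ - 1) * (A * u s ^ p)) -
            ∫ s in (0:ℝ)..t, (t - s) ^ (γ - 1) * (A * u (s + h) ^ p) := by
          simp only [mul_sub]
          exact intervalIntegral.integral_sub
            (ker_mul_ii hγ0 (hFc.mono (sub le_rfl ht)))
            (ker_mul_ii hγ0 (hFsc.mono (sub le_rfl ht)))
        rw [hueq' t ht, hueq' (t + h) (by linarith), i1, i2, i3]
        ring
    intro a ha b hb hab
    have := main (b - a) (by linarith) a ha
    rw [add_sub_cancel] at this
    linarith
  · intro t ht
    refine ⟨hlow t ht, ?_⟩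
    rw [hueq' t ht]
    have : ∫ s in (0:ℝ)..t, (t - s) ^ (γ - 1) * (A * u s ^ p) ≤
        ∫ s in (0:ℝ)..t, (t - s) ^ (γ - 1) * (A * u₀ ^ p) := by
      refine intervalIntegral.integral_mono_on ht
        (ker_mul_ii hγ0 (hFc.mono (sub le_rfl ht))) (ker_mul_ii hγ0 continuousOn_const) ?_
      intro s hs
      refine mul_le_mul_of_nonneg_left ?_ (Real.rpow_nonneg (by linarith [hs.2]) _)
      exact mul_le_mul_of_nonneg_left
        (Real.rpow_le_rpow_of_nonpos hu₀ (hlow s hs.1) hp.le) hA.le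
    rw [intervalIntegral.integral_mul_const, ker_integral hγ0, sub_zero] at this
    rw [add_comm 1 γ, Real.Gamma_add_one hγ0.ne']
    have h2 := mul_le_mul_of_nonneg_left this (show 0 ≤ 1 / Real.Gamma γ by positivity)
    refine add_le_add le_rfl (h2.trans (le_of_eq ?_))
    field_simp
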